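/- Let G be a multigraph on n ≥ 2 vertices with minimum cut value c ≥ 1, and suppose each edge fails independently with probability p ∈ [0,1], where p^c = n^{-(2+δ)} for some real δ ≥ 1. Let κ denote the (random) number of connected components of the surviving graph and let s_r = Pr[κ ≥ r]. Then for every real Q with 0 ≤ Q < (1/4)·n^{δ/4}: (i) ∑_{r=2}^{n} s_r · Q^{r−2} ≤ 2n^{−δ} (with the convention 0^0 = 1), and (ii) |E[Q^{κ−1}] − 1| ≤ 2|Q − 1|·n^{−δ}. -/

import Mathlib

open scoped Classical

/-- A multigraph on vertex type `V` is given by an edge-index type `E` together with a map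
`ends : E → Sym2 V` assigning to each edge its (unordered) pair of endpoints; the hypothesis
`∀ e, ¬ (ends e).IsDiag` says that the two endpoints of every edge are distinct.
`survGraph ends F` is the simple graph on `V` whose adjacencies are given by the edges of the
multigraph that survive when the edges in `F` fail. -/
def survGraph {V E : Type} (ends : E → Sym2 V) (F : Finset E) : SimpleGraph V :=
  SimpleGraph.fromRel (fun x y => ∃ e, e ∉ F ∧ ends e = s(x, y))

/-- The number of connected components of the graph surviving after the edges in `F` fail. -/
noncomputable def numComponents {V E : Type} (ends : E → Sym2 V) (F : Finset E) : ℕ :=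
  Nat.card (survGraph ends F).ConnectedComponent

/-- Edge `e` crosses the 2-way cut determined by the vertex set `A` (one endpoint in `A`,
one endpoint outside `A`). -/
def crosses {V E : Type} (ends : E → Sym2 V) (A : Finset V) (e : E) : Prop :=
  (∃ x ∈ ends e, x ∈ A) ∧ (∃ x ∈ ends e, x ∉ A)

/-- The edge set of the 2-way cut determined by the vertex set `A`. -/
noncomputable def cutEdges {V E : Type} [Fintype E] (ends : E → Sym2 V) (A : Finset V) :
    Finset E :=
  Finset.univ.filter (crosses ends A)

/-- The value of the 2-way cut determined by the vertex set `A`. -/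
noncomputable def cutValue {V E : Type} [Fintype E] (ends : E → Sym2 V) (A : Finset V) : ℕ :=
  (cutEdges ends A).card

/-- When each edge fails independently with probability `p`, this is the probability that the
(random) set of failed edges is a member of `S`. -/
noncomputable def failurePr {E : Type} [Fintype E] (p : ℝ) (S : Finset (Finset E)) : ℝ :=
  ∑ F ∈ S, p ^ F.card * (1 - p) ^ (Fintype.card E - F.card)

section Expectation

variable {E : Type} [Fintype E]

/-- The expectation of `h F`, where `F` is the random set of failed edges. -/
noncomputable def failureExp (h : Finset E → ℝ) (p : ℝ) : ℝ :=
  ∑ F : Finset E, p ^ F.card * (1 - p) ^ (Fintype.card E - F.card) * h F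

theorem failureWeight_nonneg {p : ℝ} (hp0 : 0 ≤ p) (hp1 : p ≤ 1) (F : Finset E) :
    0 ≤ p ^ F.card * (1 - p) ^ (Fintype.card E - F.card) :=
  mul_nonneg (pow_nonneg hp0 _) (pow_nonneg (sub_nonneg.2 hp1) _)

theorem failureExp_mono {p : ℝ} (hp0 : 0 ≤ p) (hp1 : p ≤ 1) {h k : Finset E → ℝ}
    (hk : ∀ F, h F ≤ k F) : failureExp h p ≤ failureExp k p :=
  Finset.sum_le_sum fun F _ => mul_le_mul_of_nonneg_left (hk F) (failureWeight_nonneg hp0 hp1 F)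

theorem failureExp_one (h : Finset E → ℝ) : failureExp h 1 = h Finset.univ := by
  unfold failureExp
  rw [Finset.sum_eq_single Finset.univ]
  · simp
  · intro F _ hF
    have : F.card < Fintype.card E := by
      rw [← Finset.card_univ]
      exact Finset.card_lt_card (Finset.ssubset_univ_iff.2 hF)
    rw [sub_self, zero_pow (by omega)]
    simp
  · simp

theorem failureExp_const (p a : ℝ) : failureExp (fun _ : Finset E => a) p = a := by
  unfold failureExp
  rw [← Finset.sum_mul, Fintype.sum_pow_mul_eq_add_pow]
  simp

theorem failureExp_sub (h k : Finset E → ℝ) (p : ℝ) :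
    failureExp (fun F => h F - k F) p = failureExp h p - failureExp k p := by
  simp [failureExp, mul_sub, Finset.sum_sub_distrib]

theorem failurePr_filter_eq_failureExp (P : Finset E → Prop) [DecidablePred P] (p : ℝ) :
    failurePr p (Finset.univ.filter P) = failureExp (fun F => if P F then 1 else 0) p := by
  simp [failurePr, failureExp, Finset.sum_filter]

theorem sum_weight_erase (h : Finset E → ℝ) (p : ℝ) :
    ∑ F : Finset E, ∑ _e ∈ Fᶜ, p ^ (F.card + 1) * (1 - p) ^ (Fintype.card E - F.card - 1) * h F =
      ∑ F : Finset E, ∑ e ∈ F,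
        p ^ F.card * (1 - p) ^ (Fintype.card E - F.card) * h (F.erase e) := by
  rw [Finset.sum_sigma', Finset.sum_sigma']
  refine Finset.sum_bij' (fun x _ => ⟨insert x.2 x.1, x.2⟩) (fun x _ => ⟨x.1.erase x.2, x.2⟩)
    ?_ ?_ ?_ ?_ ?_
  · simp
  · simp
  · rintro ⟨F, e⟩ hx
    have he : e ∉ F := by simpa using hx
    simp [he]
  · rintro ⟨F, e⟩ hx
    have he : e ∈ F := by simpa using hx
    simp [he]
  · rintro ⟨F, e⟩ hx
    have he : e ∉ F := by simpa using hx
    simp [he, Nat.sub_sub]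

/-- Russo's formula for the derivative of an expectation in the failure probability. -/
theorem exists_hasDerivAt_failureExp (h : Finset E → ℝ) (p : ℝ) :
    ∃ d, HasDerivAt (failureExp h) d p ∧
      p * d = failureExp (fun F => ∑ e ∈ F, (h F - h (F.erase e))) p := by
  have hd : ∀ F : Finset E, HasDerivAt
      (fun x : ℝ => x ^ F.card * (1 - x) ^ (Fintype.card E - F.card) * h F)
      ((F.card * p ^ (F.card - 1) * (1 - p) ^ (Fintype.card E - F.card) +
        p ^ F.card * ((Fintype.card E - F.card : ℕ) *
          (1 - p) ^ (Fintype.card E - F.card - 1) * (-1))) * h F) p := by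
    intro F
    have h2 : HasDerivAt (fun x : ℝ => 1 - x) (-1) p := by
      simpa using (hasDerivAt_id p).const_sub 1
    exact ((hasDerivAt_pow F.card p).mul (h2.fun_pow (Fintype.card E - F.card))).mul_const (h F)
  refine ⟨_, HasDerivAt.fun_sum fun F _ => hd F, ?_⟩
  have hR : failureExp (fun F => ∑ e ∈ F, (h F - h (F.erase e))) p =
      ∑ F : Finset E, (F.card * (p ^ F.card * (1 - p) ^ (Fintype.card E - F.card)) * h F) -
      ∑ F : Finset E, ∑ e ∈ F,
        p ^ F.card * (1 - p) ^ (Fintype.card E - F.card) * h (F.erase e) := by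
    unfold failureExp
    rw [← Finset.sum_sub_distrib]
    refine Finset.sum_congr rfl fun F _ => ?_
    beta_reduce
    rw [Finset.sum_sub_distrib, ← Finset.mul_sum, Finset.sum_const, nsmul_eq_mul]
    ring
  rw [hR, ← sum_weight_erase, ← Finset.sum_sub_distrib, Finset.mul_sum]
  refine Finset.sum_congr rfl fun F _ => ?_
  rw [Finset.sum_const, nsmul_eq_mul, Finset.card_compl]
  rcases Nat.eq_zero_or_pos F.card with h0 | h0
  · simp [h0]
    ring
  · obtain ⟨k, hk⟩ := Nat.exists_eq_add_of_lt h0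
    rw [hk]
    simp only [zero_add, Nat.add_sub_cancel]
    ring

theorem failureExp_le_rpow_mul {h : Finset E → ℝ} {a : ℝ}
    (ha : ∀ F, a * h F ≤ ∑ e ∈ F, (h F - h (F.erase e))) {p : ℝ} (hp0 : 0 < p) (hp1 : p ≤ 1) :
    failureExp h p ≤ p ^ a * h Finset.univ := by
  choose d hd hpd using exists_hasDerivAt_failureExp h
  have hder : ∀ x : ℝ, 0 < x → HasDerivAt (fun x => x ^ (-a) * failureExp h x)
      (-a * x ^ (-a - 1) * failureExp h x + x ^ (-a) * d x) x := fun x hx =>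
    (Real.hasDerivAt_rpow_const (Or.inl hx.ne')).mul (hd x)
  have hmono : MonotoneOn (fun x => x ^ (-a) * failureExp h x) (Set.Icc p 1) := by
    refine monotoneOn_of_deriv_nonneg (convex_Icc p 1)
      (fun x hx => (hder x (hp0.trans_le hx.1)).continuousAt.continuousWithinAt)
      (fun x hx => ?_) (fun x hx => ?_)
    · rw [interior_Icc] at hx
      exact (hder x (hp0.trans hx.1)).differentiableAt.differentiableWithinAt
    · rw [interior_Icc] at hx
      have hx0 : 0 < x := hp0.trans hx.1
      rw [(hder x hx0).deriv]
      have hle : a * failureExp h x ≤ x * d x := by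
        rw [hpd x]
        refine le_trans (le_of_eq ?_) (failureExp_mono hx0.le hx.2.le ha)
        unfold failureExp
        rw [Finset.mul_sum]
        exact Finset.sum_congr rfl fun F _ => by ring
      have hxa : x ^ (-a) = x ^ (-a - 1) * x := by
        rw [← Real.rpow_add_one hx0.ne']
        simp
      rw [hxa]
      nlinarith [Real.rpow_pos_of_pos hx0 (-a - 1)]
  have hfin := hmono (Set.left_mem_Icc.2 hp1) (Set.right_mem_Icc.2 hp1) hp1
  simp only [Real.one_rpow, one_mul, failureExp_one] at hfin
  calc failureExp h p = p ^ a * (p ^ (-a) * failureExp h p) := by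
        rw [← mul_assoc, ← Real.rpow_add hp0]
        simp
    _ ≤ p ^ a * h Finset.univ :=
        mul_le_mul_of_nonneg_left hfin (Real.rpow_nonneg hp0.le a)

end Expectation

section Components

variable {V E : Type} (ends : E → Sym2 V)

theorem survGraph_anti {F F' : Finset E} (h : F ⊆ F') : survGraph ends F' ≤ survGraph ends F := by
  intro x y hxy
  simp only [survGraph, SimpleGraph.fromRel_adj] at hxy ⊢
  refine ⟨hxy.1, hxy.2.imp ?_ ?_⟩ <;>
  · rintro ⟨e, he, hxy⟩
    exact ⟨e, fun h' => he (h h'), hxy⟩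

theorem connectedComponentMk_eq_of_notMem {F : Finset E} {e : E} (he : e ∉ F) {x y : V}
    (hxy : ends e = s(x, y)) :
    (survGraph ends F).connectedComponentMk x = (survGraph ends F).connectedComponentMk y := by
  by_cases h : x = y
  · rw [h]
  · refine SimpleGraph.ConnectedComponent.sound (SimpleGraph.Adj.reachable ?_)
    rw [survGraph, SimpleGraph.fromRel_adj]
    exact ⟨h, Or.inl ⟨e, he, hxy⟩⟩

variable [Fintype V]

theorem numComponents_mono {F F' : Finset E} (h : F ⊆ F') :
    numComponents ends F ≤ numComponents ends F' :=
  Nat.card_le_card_of_surjective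
    (SimpleGraph.ConnectedComponent.map (SimpleGraph.Hom.ofLE (survGraph_anti ends h)))
    (SimpleGraph.ConnectedComponent.surjective_map_ofLE _)

theorem numComponents_le_card (F : Finset E) : numComponents ends F ≤ Fintype.card V := by
  rw [← Nat.card_eq_fintype_card]
  exact Nat.card_le_card_of_surjective (survGraph ends F).connectedComponentMk Quot.mk_surjective

theorem numComponents_pos [Nonempty V] (F : Finset E) : 0 < numComponents ends F :=
  Nat.card_pos

theorem numComponents_erase_lt {F : Finset E} {e : E} {x y : V} (hxy : ends e = s(x, y))
    (hne : (survGraph ends F).connectedComponentMk x ≠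
      (survGraph ends F).connectedComponentMk y) :
    numComponents ends (F.erase e) < numComponents ends F := by
  unfold numComponents
  rw [Nat.card_eq_fintype_card, Nat.card_eq_fintype_card]
  refine Fintype.card_lt_of_surjective_not_injective
    (SimpleGraph.ConnectedComponent.map
      (SimpleGraph.Hom.ofLE (survGraph_anti ends (F.erase_subset e))))
    (SimpleGraph.ConnectedComponent.surjective_map_ofLE _) fun hinj => hne (hinj ?_)
  exact connectedComponentMk_eq_of_notMem ends (F.notMem_erase e) hxy

/-- The vertex set of a component. -/
noncomputable def componentVerts {F : Finset E} (C : (survGraph ends F).ConnectedComponent) :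
    Finset V :=
  Finset.univ.filter fun v => (survGraph ends F).connectedComponentMk v = C

theorem crosses_componentVerts {F : Finset E} {e : E} {x y : V} (hxy : ends e = s(x, y))
    {C : (survGraph ends F).ConnectedComponent} (h : crosses ends (componentVerts ends C) e) :
    (survGraph ends F).connectedComponentMk x ≠ (survGraph ends F).connectedComponentMk y ∧
      C ∈ ({(survGraph ends F).connectedComponentMk x,
        (survGraph ends F).connectedComponentMk y} : Finset _) := by
  obtain ⟨⟨u, hu, huC⟩, v, hv, hvC⟩ := h
  simp only [componentVerts, Finset.mem_filter, Finset.mem_univ, true_and] at huC hvC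
  rw [hxy, Sym2.mem_iff] at hu hv
  rcases hu with rfl | rfl <;> rcases hv with rfl | rfl <;> subst huC <;> grind

variable [Fintype E]

/-- The edges joining two different components. -/
noncomputable def interEdges (F : Finset E) : Finset E :=
  Finset.univ.filter fun e => ∃ x y, ends e = s(x, y) ∧
    (survGraph ends F).connectedComponentMk x ≠ (survGraph ends F).connectedComponentMk y

theorem mem_interEdges {F : Finset E} {e : E} : e ∈ interEdges ends F ↔ ∃ x y, ends e = s(x, y) ∧
    (survGraph ends F).connectedComponentMk x ≠ (survGraph ends F).connectedComponentMk y := by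
  simp [interEdges]

theorem interEdges_subset (F : Finset E) : interEdges ends F ⊆ F := by
  intro e he
  obtain ⟨x, y, hxy, hne⟩ := (mem_interEdges ends).1 he
  by_contra h
  exact hne (connectedComponentMk_eq_of_notMem ends h hxy)

theorem sum_cutValue_le (F : Finset E) [Fintype (survGraph ends F).ConnectedComponent] :
    ∑ C : (survGraph ends F).ConnectedComponent, cutValue ends (componentVerts ends C) ≤
      2 * (interEdges ends F).card := by
  have hcard : ∀ C : (survGraph ends F).ConnectedComponent,
      cutValue ends (componentVerts ends C) =
        ∑ e ∈ interEdges ends F, if crosses ends (componentVerts ends C) e then 1 else 0 := by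
    intro C
    rw [cutValue, cutEdges, ← Finset.card_filter]
    congr 1
    ext e
    simp only [Finset.mem_filter, Finset.mem_univ, true_and, mem_interEdges, iff_and_self]
    intro h
    obtain ⟨⟨x, y⟩, hxy⟩ := Quot.exists_rep (ends e)
    exact ⟨x, y, hxy.symm, (crosses_componentVerts ends hxy.symm h).1⟩
  simp_rw [hcard]
  rw [Finset.sum_comm, mul_comm, ← smul_eq_mul]
  refine Finset.sum_le_card_nsmul _ _ _ fun e he => ?_
  obtain ⟨x, y, hxy, -⟩ := (mem_interEdges ends).1 he
  rw [← Finset.card_filter]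
  refine (Finset.card_le_card fun C hC => ?_).trans (Finset.card_le_two
    (a := (survGraph ends F).connectedComponentMk x)
    (b := (survGraph ends F).connectedComponentMk y))
  exact (crosses_componentVerts ends hxy (Finset.mem_filter.1 hC).2).2

theorem pow_sub_one_eq_sum_Icc {κ n : ℕ} (hκ : 0 < κ) (hκn : κ ≤ n) (Q : ℝ) :
    Q ^ (κ - 1) - 1 =
      (Q - 1) * ∑ r ∈ Finset.Icc 2 n, (if r ≤ κ then 1 else 0) * Q ^ (r - 2) := by
  have h : (∑ r ∈ Finset.Icc 2 n, (if r ≤ κ then (1 : ℝ) else 0) * Q ^ (r - 2)) =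
      ∑ i ∈ Finset.range (κ - 1), Q ^ i := by
    simp only [ite_mul, one_mul, zero_mul]
    rw [← Finset.sum_filter]
    have : (Finset.Icc 2 n).filter (· ≤ κ) = Finset.Ico 2 (κ + 1) := by
      ext r
      simp only [Finset.mem_filter, Finset.mem_Icc, Finset.mem_Ico]
      omega
    rw [this, Finset.sum_Ico_eq_sum_range]
    simp [show κ + 1 - 2 = κ - 1 by omega]
  rw [h, mul_geom_sum]

theorem failureExp_pow_sub_one [Nonempty V] (p Q : ℝ) :
    failureExp (fun F => Q ^ (numComponents ends F - 1)) p - 1 =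
      (Q - 1) * ∑ r ∈ Finset.Icc 2 (Fintype.card V),
        failurePr p (Finset.univ.filter (fun F : Finset E => r ≤ numComponents ends F)) *
          Q ^ (r - 2) := by
  have h1 : failureExp (fun F => Q ^ (numComponents ends F - 1)) p - 1 =
      failureExp (fun F => Q ^ (numComponents ends F - 1) - 1) p := by
    rw [failureExp_sub, failureExp_const]
  simp_rw [h1, failurePr_filter_eq_failureExp,
    pow_sub_one_eq_sum_Icc (numComponents_pos ends _) (numComponents_le_card ends _)]
  unfold failureExp
  simp_rw [Finset.mul_sum, Finset.sum_mul, Finset.mul_sum]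
  rw [Finset.sum_comm]
  exact Finset.sum_congr rfl fun r _ => Finset.sum_congr rfl fun F _ => by ring

variable [DecidableEq V]

theorem numComponents_mul_le {c : ℕ}
    (hmin : ∀ A : Finset V, A.Nonempty → Aᶜ.Nonempty → c ≤ cutValue ends A)
    {F : Finset E} (hF : 2 ≤ numComponents ends F) :
    numComponents ends F * c ≤ 2 * (interEdges ends F).card := by
  refine le_trans ?_ (sum_cutValue_le ends F)
  rw [numComponents, Nat.card_eq_fintype_card] at hF ⊢
  rw [← Finset.card_univ, ← smul_eq_mul]
  refine Finset.card_nsmul_le_sum _ _ _ fun C _ => hmin (componentVerts ends C) ?_ ?_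
  · obtain ⟨v, hv⟩ := Quot.exists_rep C
    exact ⟨v, Finset.mem_filter.2 ⟨Finset.mem_univ v, hv⟩⟩
  · have : Nontrivial (survGraph ends F).ConnectedComponent := Fintype.one_lt_card_iff_nontrivial.1 hF
    obtain ⟨D, hD⟩ := exists_ne C
    obtain ⟨v, rfl⟩ := Quot.exists_rep D
    exact ⟨v, Finset.mem_compl.2 fun h => hD (Finset.mem_filter.1 h).2⟩

theorem choose_numComponents_drift {c : ℕ}
    (hmin : ∀ A : Finset V, A.Nonempty → Aᶜ.Nonempty → c ≤ cutValue ends A)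
    {r : ℕ} (hr : 2 ≤ r) (F : Finset E) :
    ((c : ℝ) * r / 2) * ((numComponents ends F).choose r : ℝ) ≤
      ∑ e ∈ F, (((numComponents ends F).choose r : ℝ) -
        ((numComponents ends (F.erase e)).choose r : ℝ)) := by
  have hnn : ∀ e ∈ F, (0 : ℝ) ≤ ((numComponents ends F).choose r : ℝ) -
      ((numComponents ends (F.erase e)).choose r : ℝ) := fun e _ => by
    rw [sub_nonneg, Nat.cast_le]
    exact Nat.choose_le_choose r (numComponents_mono ends (F.erase_subset e))
  rcases lt_or_ge (numComponents ends F) 2 with hlt | hge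
  · rw [Nat.choose_eq_zero_of_lt (hlt.trans_le hr)] at hnn ⊢
    simpa using Finset.sum_nonneg hnn
  obtain ⟨k, hk⟩ := Nat.exists_eq_add_of_le' (one_le_two.trans hge)
  obtain ⟨s, rfl⟩ := Nat.exists_eq_add_of_le' (one_le_two.trans hr)
  refine le_trans ?_ (Finset.sum_le_sum_of_subset_of_nonneg (interEdges_subset ends F)
    fun e he _ => hnn e he)
  have hstep : ∀ e ∈ interEdges ends F, (k.choose s : ℝ) ≤
      ((numComponents ends F).choose (s + 1) : ℝ) -
        ((numComponents ends (F.erase e)).choose (s + 1) : ℝ) := by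
    intro e he
    obtain ⟨x, y, hxy, hne⟩ := (mem_interEdges ends).1 he
    have hlt := numComponents_erase_lt ends hxy hne
    rw [le_sub_iff_add_le, hk, Nat.choose_succ_succ']
    have hle := Nat.choose_le_choose (s + 1) (show numComponents ends (F.erase e) ≤ k by omega)
    push_cast
    gcongr
  refine le_trans ?_ (Finset.card_nsmul_le_sum _ _ _ hstep)
  have hM : ((k + 1 : ℕ) : ℝ) * c ≤ 2 * (interEdges ends F).card := by
    rw [← hk]
    exact_mod_cast numComponents_mul_le ends hmin hge
  have habs : ((k + 1 : ℕ) : ℝ) * k.choose s = (k + 1).choose (s + 1) * (s + 1 : ℕ) := by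
    exact_mod_cast Nat.add_one_mul_choose_eq k s
  rw [hk, nsmul_eq_mul]
  calc (c : ℝ) * (s + 1 : ℕ) / 2 * ((k + 1).choose (s + 1) : ℝ)
      = c / 2 * ((k + 1).choose (s + 1) * (s + 1 : ℕ)) := by ring
    _ = ((k + 1 : ℕ) * c) / 2 * k.choose s := by rw [← habs]; ring
    _ ≤ (interEdges ends F).card * (k.choose s : ℝ) :=
        mul_le_mul_of_nonneg_right (by linarith) (Nat.cast_nonneg _)

theorem failurePr_le_numComponents {c : ℕ}
    (hmin : ∀ A : Finset V, A.Nonempty → Aᶜ.Nonempty → c ≤ cutValue ends A)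
    {r : ℕ} (hr : 2 ≤ r) {p : ℝ} (hp0 : 0 < p) (hp1 : p ≤ 1) :
    failurePr p (Finset.univ.filter (fun F : Finset E => r ≤ numComponents ends F)) ≤
      p ^ ((c : ℝ) * r / 2) * (Fintype.card V : ℝ) ^ r := by
  rw [failurePr_filter_eq_failureExp]
  calc _ ≤ failureExp (fun F => ((numComponents ends F).choose r : ℝ)) p := by
        refine failureExp_mono hp0.le hp1 fun F => ?_
        split_ifs with h
        · exact_mod_cast Nat.choose_pos h
        · positivity
    _ ≤ p ^ ((c : ℝ) * r / 2) * ((numComponents ends Finset.univ).choose r : ℝ) :=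
        failureExp_le_rpow_mul (choose_numComponents_drift ends hmin hr) hp0 hp1
    _ ≤ _ := by
        refine mul_le_mul_of_nonneg_left ?_ (Real.rpow_nonneg hp0.le _)
        exact_mod_cast (Nat.choose_le_choose r (numComponents_le_card ends _)).trans
          (Nat.choose_le_pow _ _)

/-- The probability that the number of components is at least `r` is at most `n ^ (-rδ/2)`. -/
theorem failurePr_le_rpow {c : ℕ}
    (hmin : ∀ A : Finset V, A.Nonempty → Aᶜ.Nonempty → c ≤ cutValue ends A)
    {r : ℕ} (hr : 2 ≤ r) {p δ : ℝ} (hp0 : 0 < p) (hp1 : p ≤ 1) (hn : 0 < Fintype.card V)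
    (hpc : p ^ c = (Fintype.card V : ℝ) ^ (-(2 + δ))) :
    failurePr p (Finset.univ.filter (fun F : Finset E => r ≤ numComponents ends F)) ≤
      (Fintype.card V : ℝ) ^ (-(δ * r / 2)) := by
  refine (failurePr_le_numComponents ends hmin hr hp0 hp1).trans (le_of_eq ?_)
  have hn' : (0 : ℝ) < Fintype.card V := Nat.cast_pos.2 hn
  rw [mul_div_assoc, Real.rpow_mul hp0.le, Real.rpow_natCast, hpc, ← Real.rpow_mul hn'.le,
    ← Real.rpow_natCast (Fintype.card V : ℝ) r, ← Real.rpow_add hn']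
  congr 1
  ring

theorem sum_failurePr_mul_pow_le {c : ℕ}
    (hmin : ∀ A : Finset V, A.Nonempty → Aᶜ.Nonempty → c ≤ cutValue ends A)
    {p δ : ℝ} (hp0 : 0 < p) (hp1 : p ≤ 1) (hδ : 0 ≤ δ) (hn : 0 < Fintype.card V)
    (hpc : p ^ c = (Fintype.card V : ℝ) ^ (-(2 + δ)))
    {Q : ℝ} (hQ0 : 0 ≤ Q) (hQ : Q ≤ (1 / 4) * (Fintype.card V : ℝ) ^ (δ / 4)) :
    (∑ r ∈ Finset.Icc 2 (Fintype.card V),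
        failurePr p (Finset.univ.filter (fun F : Finset E => r ≤ numComponents ends F)) *
          Q ^ (r - 2))
      ≤ 2 * (Fintype.card V : ℝ) ^ (-δ) := by
  have hn' : (0 : ℝ) < Fintype.card V := Nat.cast_pos.2 hn
  have hn1 : (1 : ℝ) ≤ Fintype.card V := by exact_mod_cast hn
  have hterm : ∀ r ∈ Finset.Icc 2 (Fintype.card V),
      failurePr p (Finset.univ.filter (fun F : Finset E => r ≤ numComponents ends F)) *
        Q ^ (r - 2) ≤ (Fintype.card V : ℝ) ^ (-δ) * (1 / 4) ^ (r - 2) := by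
    intro r hr
    obtain ⟨k, rfl⟩ := Nat.exists_eq_add_of_le' (Finset.mem_Icc.1 hr).1
    rw [Nat.add_sub_cancel]
    calc _ ≤ (Fintype.card V : ℝ) ^ (-(δ * (k + 2 : ℕ) / 2)) *
          ((1 / 4) * (Fintype.card V : ℝ) ^ (δ / 4)) ^ k :=
          mul_le_mul (failurePr_le_rpow ends hmin (by omega) hp0 hp1 hn hpc)
            (pow_le_pow_left₀ hQ0 hQ k) (pow_nonneg hQ0 k) (Real.rpow_nonneg hn'.le _)
      _ = (Fintype.card V : ℝ) ^ (-δ - δ * k / 4) * (1 / 4) ^ k := by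
          rw [mul_pow, ← Real.rpow_mul_natCast hn'.le, mul_left_comm, ← Real.rpow_add hn',
            mul_comm]
          congr 2
          push_cast
          ring
      _ ≤ _ := by
          refine mul_le_mul_of_nonneg_right ?_ (by positivity)
          refine Real.rpow_le_rpow_of_exponent_le hn1 ?_
          have : 0 ≤ δ * k / 4 := by positivity
          linarith
  refine (Finset.sum_le_sum hterm).trans ?_
  rw [← Finset.mul_sum, mul_comm]
  refine mul_le_mul_of_nonneg_right ?_ (Real.rpow_nonneg hn'.le _)
  rw [← Finset.Ico_add_one_right_eq_Icc, Finset.sum_Ico_eq_sum_range]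
  simp only [Nat.add_sub_cancel_left]
  rw [geom_sum_eq (by norm_num)]
  have : (0 : ℝ) ≤ (1 / 4) ^ (Fintype.card V + 1 - 2) := by positivity
  rw [div_le_iff_of_neg (by norm_num)]
  linarith

end Components

/-- Let `G` be a multigraph on `n ≥ 2` vertices with minimum cut value `c ≥ 1`
whose edges fail independently with probability `p ∈ [0,1]`, where `p ^ c = n ^ (-(2+δ))` for
some real `δ ≥ 1`.  Let `κ` be the (random) number of connected components of the surviving
graph and `s_r = Pr[κ ≥ r]`.  Then for every real `Q` with `0 ≤ Q < (1/4) n^(δ/4)`: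
(i) `∑_{r=2}^{n} s_r Q^(r-2) ≤ 2 n^(-δ)` (with `0^0 = 1`), and
(ii) `|E[Q^(κ-1)] - 1| ≤ 2 |Q - 1| n^(-δ)`. -/
theorem stmt19 {V E : Type} [Fintype V] [DecidableEq V] [Fintype E]
    (ends : E → Sym2 V) (hnd : ∀ e, ¬ (ends e).IsDiag)
    (hn : 2 ≤ Fintype.card V) (c : ℕ) (hc : 1 ≤ c)
    (hmin : ∀ A : Finset V, A.Nonempty → Aᶜ.Nonempty → c ≤ cutValue ends A)
    (hex : ∃ A : Finset V, A.Nonempty ∧ Aᶜ.Nonempty ∧ cutValue ends A = c)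
    (p δ : ℝ) (hp0 : 0 ≤ p) (hp1 : p ≤ 1) (hδ : 1 ≤ δ)
    (hpc : p ^ c = (Fintype.card V : ℝ) ^ (-(2 + δ)))
    (Q : ℝ) (hQ0 : 0 ≤ Q) (hQ : Q < (1 / 4) * (Fintype.card V : ℝ) ^ (δ / 4)) :
    (∑ r ∈ Finset.Icc 2 (Fintype.card V),
        failurePr p (Finset.univ.filter (fun F : Finset E => r ≤ numComponents ends F)) *
          Q ^ (r - 2))
      ≤ 2 * (Fintype.card V : ℝ) ^ (-δ) ∧
    |(∑ F : Finset E,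
        p ^ F.card * (1 - p) ^ (Fintype.card E - F.card) * Q ^ (numComponents ends F - 1)) - 1|
      ≤ 2 * |Q - 1| * (Fintype.card V : ℝ) ^ (-δ) := by
  have hn0 : 0 < Fintype.card V := two_pos.trans_le hn
  have : Nonempty V := Fintype.card_pos_iff.1 hn0
  have hp : 0 < p := by
    refine hp0.lt_of_ne fun h => ?_
    have hpos := Real.rpow_pos_of_pos (Nat.cast_pos.2 hn0 : (0 : ℝ) < Fintype.card V) (-(2 + δ))
    rw [← hpc, ← h, zero_pow (by omega)] at hpos
    exact hpos.false
  have hsum := sum_failurePr_mul_pow_le ends hmin hp hp1 (by linarith) hn0 hpc hQ0 hQ.le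
  refine ⟨hsum, ?_⟩
  change |failureExp (fun F => Q ^ (numComponents ends F - 1)) p - 1| ≤ _
  have hnn : 0 ≤ ∑ r ∈ Finset.Icc 2 (Fintype.card V),
      failurePr p (Finset.univ.filter (fun F : Finset E => r ≤ numComponents ends F)) *
        Q ^ (r - 2) :=
    Finset.sum_nonneg fun r _ => mul_nonneg
      (Finset.sum_nonneg fun F _ => failureWeight_nonneg hp0 hp1 F) (pow_nonneg hQ0 _)
  rw [failureExp_pow_sub_one, abs_mul, abs_of_nonneg hnn]
  calc _ ≤ |Q - 1| * (2 * (Fintype.card V : ℝ) ^ (-δ)) :=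
        mul_le_mul_of_nonneg_left hsum (abs_nonneg _)
    _ = _ := by ring
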